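/- arXiv:2303.02942 — 3 statements merged into one kernel-verified Lean document; each statement's English description precedes it below -/
import Mathlib

section
/- For every integer n ≥ 2 and all p_A, p_B ∈ [0,1] with p_A + p_B > 0, the first-serving team's advantage under side-out scoring is a symmetric function of the two rally-win probabilities: f_n(p_A, p_B) = f_n(p_B, p_A). -/
/-- The four server designations in side-out scoring: Team A's first and second
servers and Team B's first and second servers. -/
inductive SOSrv : Type
  | A1 | A2 | B1 | B2
  deriving DecidableEq

/-- States of a game to `n` with four server designations: a (capped) score `(i, j)`
together with a server designation, or one of the two absorbing states. -/
inductive SOState (n : ℕ) : Type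
  | game (i j : ℕ) (srv : SOSrv)
  | Awins
  | Bwins
  deriving DecidableEq

/-- The capped scores of a game to `n`: both scores at most `n - 1`, or one of the two
advantage scores `(n - 1, n)`, `(n, n - 1)`. -/
def validScore (n i j : ℕ) : Prop :=
  (i ≤ n - 1 ∧ j ≤ n - 1) ∨ (i = n - 1 ∧ j = n) ∨ (i = n ∧ j = n - 1)

/-- Result of Team A scoring a point from (capped) score `(i, j)`, with server `srv`:
from deuce `(n-1, n-1)` to advantage `(n, n-1)`; from Team B's advantage `(n-1, n)`
back to deuce; from advantage `(n, n-1)` or from `(n-1, j)` with `j ≤ n-2`, Team A wins;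
otherwise the score is incremented. -/
def soScoreA (n i j : ℕ) (srv : SOSrv) : SOState n :=
  if i = n - 1 then
    if j = n - 1 then SOState.game n (n - 1) srv
    else if j = n then SOState.game (n - 1) (n - 1) srv
    else SOState.Awins
  else if i = n then SOState.Awins
  else SOState.game (i + 1) j srv

/-- Result of Team B scoring a point from (capped) score `(i, j)`, with server `srv`. -/
def soScoreB (n i j : ℕ) (srv : SOSrv) : SOState n :=
  if j = n - 1 then
    if i = n - 1 then SOState.game (n - 1) n srv
    else if i = n then SOState.game (n - 1) (n - 1) srv
    else SOState.Bwins
  else if j = n then SOState.Bwins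
  else SOState.game i (j + 1) srv

/-- `soDist n pA pB k s t` : the probability that a side-out scoring game to `n` is in
state `t` after `k` rallies, starting from state `s`.  When Team A serves it wins the
rally with probability `pA` (scoring a point and keeping the server); otherwise the
server designation advances `A1 → A2 → B1 → B2 → A1` (side out after two faults;
the game starts with the first-serving team's second server).  Similarly for Team B
with `pB`.  The absorbing states stay put. -/
def soDist (n : ℕ) (pA pB : ℝ) : ℕ → SOState n → SOState n → ℝ
  | 0, s, t => if t = s then 1 else 0
  | k + 1, SOState.Awins, t => soDist n pA pB k SOState.Awins t
  | k + 1, SOState.Bwins, t => soDist n pA pB k SOState.Bwins t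
  | k + 1, SOState.game i j SOSrv.A1, t =>
      pA * soDist n pA pB k (soScoreA n i j SOSrv.A1) t
        + (1 - pA) * soDist n pA pB k (SOState.game i j SOSrv.A2) t
  | k + 1, SOState.game i j SOSrv.A2, t =>
      pA * soDist n pA pB k (soScoreA n i j SOSrv.A2) t
        + (1 - pA) * soDist n pA pB k (SOState.game i j SOSrv.B1) t
  | k + 1, SOState.game i j SOSrv.B1, t =>
      pB * soDist n pA pB k (soScoreB n i j SOSrv.B1) t
        + (1 - pB) * soDist n pA pB k (SOState.game i j SOSrv.B2) t
  | k + 1, SOState.game i j SOSrv.B2, t =>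
      pB * soDist n pA pB k (soScoreB n i j SOSrv.B2) t
        + (1 - pB) * soDist n pA pB k (SOState.game i j SOSrv.A1) t

/-- Probability that Team A eventually wins the side-out scoring game, from state `s`. -/
noncomputable def soWinA (n : ℕ) (pA pB : ℝ) (s : SOState n) : ℝ :=
  ⨆ k : ℕ, soDist n pA pB k s SOState.Awins

/-- Probability that Team B eventually wins the side-out scoring game, from state `s`. -/
noncomputable def soWinB (n : ℕ) (pA pB : ℝ) (s : SOState n) : ℝ :=
  ⨆ k : ℕ, soDist n pA pB k s SOState.Bwins

/-- The first-serving team's advantage `f_n(p_A, p_B)` under side-out scoring to `n`: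
P(Team A wins | Team A serves first) − P(Team A wins | Team B serves first).
The game starts at score 0-0 with the first-serving team's second server. -/
noncomputable def soAdv (n : ℕ) (pA pB : ℝ) : ℝ :=
  soWinA n pA pB (SOState.game 0 0 SOSrv.A2) - soWinA n pA pB (SOState.game 0 0 SOSrv.B2)

open Filter Topology

/-- The server designation that follows a lost rally. -/
def SOSrv.next : SOSrv → SOSrv
  | A1 => A2
  | A2 => B1
  | B1 => B2
  | B2 => A1

/-- The server designation after exchanging the names of the two teams. -/
def SOSrv.swap : SOSrv → SOSrv
  | A1 => B1
  | A2 => B2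
  | B1 => A1
  | B2 => A2

/-- The probability that the serving team wins the rally. -/
def SOSrv.prob (pA pB : ℝ) : SOSrv → ℝ
  | A1 => pA
  | A2 => pA
  | B1 => pB
  | B2 => pB

/-- The state after the serving team scores a point. -/
def soScore (n i j : ℕ) : SOSrv → SOState n
  | SOSrv.A1 => soScoreA n i j SOSrv.A1
  | SOSrv.A2 => soScoreA n i j SOSrv.A2
  | SOSrv.B1 => soScoreB n i j SOSrv.B1
  | SOSrv.B2 => soScoreB n i j SOSrv.B2

/-- The state after exchanging the names of the two teams. -/
def SOState.swap {n : ℕ} : SOState n → SOState n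
  | game i j srv => game j i srv.swap
  | Awins => Bwins
  | Bwins => Awins

lemma SOSrv.prob_mem {pA pB : ℝ} (hA : pA ∈ Set.Icc (0 : ℝ) 1) (hB : pB ∈ Set.Icc (0 : ℝ) 1)
    (srv : SOSrv) : srv.prob pA pB ∈ Set.Icc (0 : ℝ) 1 := by
  cases srv <;> assumption

lemma SOSrv.prob_swap (pA pB : ℝ) (srv : SOSrv) : srv.swap.prob pB pA = srv.prob pA pB := by
  cases srv <;> rfl

lemma SOSrv.next_swap (srv : SOSrv) : srv.swap.next = srv.next.swap := by
  cases srv <;> rfl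

lemma SOState.swap_swap {n : ℕ} (s : SOState n) : s.swap.swap = s := by
  rcases s with ⟨i, j, _ | _ | _ | _⟩ | _ | _ <;> rfl

lemma SOState.swap_injective {n : ℕ} : Function.Injective (SOState.swap (n := n)) :=
  Function.LeftInverse.injective SOState.swap_swap

lemma soScoreA_eq_Awins {n i j : ℕ} (hn : 1 ≤ n) (srv : SOSrv)
    (h : i = n ∨ (i + 1 = n ∧ j < i)) : soScoreA n i j srv = SOState.Awins := by
  unfold soScoreA
  split_ifs <;> first | rfl | omega

lemma soScore_swap (n i j : ℕ) (srv : SOSrv) :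
    soScore n j i srv.swap = (soScore n i j srv).swap := by
  cases srv <;> simp only [soScore, SOSrv.swap, soScoreA, soScoreB] <;> split_ifs <;> rfl

lemma soDist_succ_game (n : ℕ) (pA pB : ℝ) (k i j : ℕ) (srv : SOSrv) (t : SOState n) :
    soDist n pA pB (k + 1) (SOState.game i j srv) t =
      srv.prob pA pB * soDist n pA pB k (soScore n i j srv) t
        + (1 - srv.prob pA pB) * soDist n pA pB k (SOState.game i j srv.next) t := by
  cases srv <;> rfl

lemma soDist_swap (n : ℕ) (pA pB : ℝ) (k : ℕ) (s t : SOState n) :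
    soDist n pB pA k s.swap t.swap = soDist n pA pB k s t := by
  induction k generalizing s with
  | zero => simp only [soDist, SOState.swap_injective.eq_iff]
  | succ k ih =>
    rcases s with ⟨i, j, srv⟩ | _ | _
    · rw [SOState.swap, soDist_succ_game, soDist_succ_game, SOSrv.prob_swap, soScore_swap,
        SOSrv.next_swap, ih, ← ih (SOState.game i j srv.next)]
      rfl
    · exact ih SOState.Awins
    · exact ih SOState.Bwins

lemma soWinA_swap (n : ℕ) (pA pB : ℝ) (s : SOState n) :
    soWinA n pB pA s.swap = soWinB n pA pB s :=
  iSup_congr fun k => soDist_swap n pA pB k s SOState.Bwins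

section Convergence

variable {n : ℕ} {pA pB : ℝ}

lemma soDist_nonneg (hA : pA ∈ Set.Icc (0 : ℝ) 1) (hB : pB ∈ Set.Icc (0 : ℝ) 1)
    (k : ℕ) (s t : SOState n) : 0 ≤ soDist n pA pB k s t := by
  induction k generalizing s with
  | zero => simp only [soDist]; split_ifs <;> norm_num
  | succ k ih =>
    rcases s with ⟨i, j, srv⟩ | _ | _
    · rw [soDist_succ_game]
      have h := srv.prob_mem hA hB
      exact add_nonneg (mul_nonneg h.1 (ih _)) (mul_nonneg (sub_nonneg.2 h.2) (ih _))
    · exact ih _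
    · exact ih _

lemma soDist_Awins (k : ℕ) (t : SOState n) :
    soDist n pA pB k SOState.Awins t = if t = SOState.Awins then 1 else 0 := by
  induction k with
  | zero => rfl
  | succ k ih => exact ih

lemma soDist_Bwins (k : ℕ) (t : SOState n) :
    soDist n pA pB k SOState.Bwins t = if t = SOState.Bwins then 1 else 0 := by
  induction k with
  | zero => rfl
  | succ k ih => exact ih

lemma soDist_Awins_add_Bwins_le_one (hA : pA ∈ Set.Icc (0 : ℝ) 1) (hB : pB ∈ Set.Icc (0 : ℝ) 1)
    (k : ℕ) (s : SOState n) :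
    soDist n pA pB k s SOState.Awins + soDist n pA pB k s SOState.Bwins ≤ 1 := by
  induction k generalizing s with
  | zero => rcases s with ⟨i, j, srv⟩ | _ | _ <;> simp [soDist]
  | succ k ih =>
    rcases s with ⟨i, j, srv⟩ | _ | _
    · rw [soDist_succ_game, soDist_succ_game]
      have h := srv.prob_mem hA hB
      have h1 := mul_le_mul_of_nonneg_left (ih (soScore n i j srv)) h.1
      have h2 := mul_le_mul_of_nonneg_left (ih (SOState.game i j srv.next)) (sub_nonneg.2 h.2)
      linarith
    · exact ih _
    · exact ih _

lemma monotone_soDist (hA : pA ∈ Set.Icc (0 : ℝ) 1) (hB : pB ∈ Set.Icc (0 : ℝ) 1)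
    (s : SOState n) {t : SOState n} (ht : t = SOState.Awins ∨ t = SOState.Bwins) :
    Monotone fun k => soDist n pA pB k s t := by
  refine monotone_nat_of_le_succ fun k => ?_
  induction k generalizing s with
  | zero =>
    rcases s with ⟨i, j, srv⟩ | _ | _
    · have h0 : soDist n pA pB 0 (SOState.game i j srv) t = 0 := by
        rcases ht with rfl | rfl <;> simp [soDist]
      exact h0.trans_le (soDist_nonneg hA hB _ _ _)
    · exact le_rfl
    · exact le_rfl
  | succ k ih =>
    rcases s with ⟨i, j, srv⟩ | _ | _
    · rw [soDist_succ_game, soDist_succ_game n pA pB (k + 1)]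
      have h := srv.prob_mem hA hB
      exact add_le_add (mul_le_mul_of_nonneg_left (ih _) h.1)
        (mul_le_mul_of_nonneg_left (ih _) (sub_nonneg.2 h.2))
    · exact ih _
    · exact ih _

lemma tendsto_soWinA (hA : pA ∈ Set.Icc (0 : ℝ) 1) (hB : pB ∈ Set.Icc (0 : ℝ) 1)
    (s : SOState n) :
    Tendsto (fun k => soDist n pA pB k s SOState.Awins) atTop (𝓝 (soWinA n pA pB s)) := by
  refine tendsto_atTop_ciSup (monotone_soDist hA hB s (Or.inl rfl)) ⟨1, ?_⟩
  rintro _ ⟨k, rfl⟩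
  have h1 := soDist_Awins_add_Bwins_le_one hA hB k s
  have h2 := soDist_nonneg hA hB k s SOState.Bwins
  dsimp only
  linarith

lemma tendsto_soWinB (hA : pA ∈ Set.Icc (0 : ℝ) 1) (hB : pB ∈ Set.Icc (0 : ℝ) 1)
    (s : SOState n) :
    Tendsto (fun k => soDist n pA pB k s SOState.Bwins) atTop (𝓝 (soWinB n pA pB s)) := by
  refine tendsto_atTop_ciSup (monotone_soDist hA hB s (Or.inr rfl)) ⟨1, ?_⟩
  rintro _ ⟨k, rfl⟩
  have h1 := soDist_Awins_add_Bwins_le_one hA hB k s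
  have h2 := soDist_nonneg hA hB k s SOState.Awins
  dsimp only
  linarith

end Convergence

/-- A function on states that vanishes at the absorbing states and is invariant in
expectation under playing one rally. -/
structure SOHarmonic (n : ℕ) (pA pB : ℝ) (q : SOState n → ℝ) : Prop where
  awins : q SOState.Awins = 0
  bwins : q SOState.Bwins = 0
  game (i j : ℕ) (srv : SOSrv) : q (SOState.game i j srv) =
    srv.prob pA pB * q (soScore n i j srv)
      + (1 - srv.prob pA pB) * q (SOState.game i j srv.next)

/-- The probability that the game never ends, as a function of the state. -/
lemma soHarmonic_one_sub {n : ℕ} {pA pB : ℝ}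
    (hA : pA ∈ Set.Icc (0 : ℝ) 1) (hB : pB ∈ Set.Icc (0 : ℝ) 1) :
    SOHarmonic n pA pB fun s => 1 - (soWinA n pA pB s + soWinB n pA pB s) where
  awins := by simp [soWinA, soWinB, soDist_Awins]
  bwins := by simp [soWinA, soWinB, soDist_Bwins]
  game i j srv := by
    have hwin := fun s => (tendsto_soWinA (n := n) hA hB s).add (tendsto_soWinB hA hB s)
    have h := tendsto_nhds_unique ((tendsto_add_atTop_iff_nat 1).2 (hwin (SOState.game i j srv)))
      ((((hwin (soScore n i j srv)).const_mul (srv.prob pA pB)).add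
        ((hwin (SOState.game i j srv.next)).const_mul (1 - srv.prob pA pB))).congr fun k => by
          rw [soDist_succ_game, soDist_succ_game]; ring)
    rw [h]
    ring

namespace SOHarmonic

variable {n : ℕ} {pA pB : ℝ} {q : SOState n → ℝ}

lemma swap (hq : SOHarmonic n pA pB q) : SOHarmonic n pB pA (q ∘ SOState.swap) where
  awins := hq.bwins
  bwins := hq.awins
  game i j srv := by
    have h := hq.game j i srv.swap
    rw [SOSrv.prob_swap pB pA, soScore_swap, SOSrv.next_swap] at h
    exact h

/-- From a score at which at most `d + 1` points in a row win the game for Team A, Team A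
serving, the value is bounded away from `m` by the chance of scoring these points. -/
lemma le_of_serve_A_of_points (hq : SOHarmonic n pA pB q) (hn : 1 ≤ n)
    (hA : pA ∈ Set.Icc (0 : ℝ) 1) {m : ℝ} (hm : 0 ≤ m)
    (hqm : ∀ i j srv, i ≤ n → j ≤ n → q (SOState.game i j srv) ≤ m)
    {srv : SOSrv} (hsrv : srv = SOSrv.A1 ∨ srv = SOSrv.A2) (d i j : ℕ) (hi : i ≤ n) (hj : j ≤ n)
    (hd : i = n ∨ (i + 1 = n ∧ i = j ∧ 1 ≤ d) ∨ (i + 1 = n ∧ j = n ∧ 2 ≤ d) ∨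
      (i + 1 = n ∧ j < i) ∨ n + 2 ≤ d + i) :
    q (SOState.game i j srv) ≤ (1 - pA ^ (d + 1)) * m := by
  have hprob : srv.prob pA pB = pA := by rcases hsrv with rfl | rfl <;> rfl
  have hscore : ∀ i j, soScore n i j srv = soScoreA n i j srv := by
    rcases hsrv with rfl | rfl <;> exact fun _ _ => rfl
  have key : ∀ d e i j, e ≤ d → i ≤ n → j ≤ n → q (soScoreA n i j srv) ≤ (1 - pA ^ e) * m →
      q (SOState.game i j srv) ≤ (1 - pA ^ (d + 1)) * m := by
    intro d e i j he hi hj h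
    rw [hq.game, hprob, hscore]
    have h1 := mul_le_mul_of_nonneg_left h hA.1
    have h2 : pA ^ (d + 1) * m ≤ pA ^ (e + 1) * m :=
      mul_le_mul_of_nonneg_right (pow_le_pow_of_le_one hA.1 hA.2 (by omega)) hm
    have h3 : pA * ((1 - pA ^ e) * m) = pA * m - pA ^ (e + 1) * m := by ring
    have h4 := mul_le_mul_of_nonneg_left (hqm i j srv.next hi hj) (sub_nonneg.2 hA.2)
    linarith
  have hwin : ∀ d i j, i ≤ n → j ≤ n → soScoreA n i j srv = SOState.Awins →
      q (SOState.game i j srv) ≤ (1 - pA ^ (d + 1)) * m := by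
    intro d i j hi hj h
    refine key d 0 i j d.zero_le hi hj ?_
    rw [h, hq.awins]
    simp
  induction d generalizing i j with
  | zero =>
    exact hwin 0 i j hi hj (soScoreA_eq_Awins hn srv (by omega))
  | succ d ih =>
    by_cases hi' : i = n
    · exact hwin _ i j hi hj (soScoreA_eq_Awins hn srv (by omega))
    by_cases hi1 : i + 1 = n
    · by_cases hji : j < i
      · exact hwin _ i j hi hj (soScoreA_eq_Awins hn srv (by omega))
      refine key _ _ i j le_rfl hi hj ?_
      by_cases hj' : j = n
      · have : soScoreA n i j srv = SOState.game (n - 1) (n - 1) srv := by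
          rw [soScoreA, if_pos (by omega), if_neg (by omega), if_pos (by omega)]
        rw [this]
        exact ih _ _ (by omega) (by omega) (by omega)
      · have : soScoreA n i j srv = SOState.game n (n - 1) srv := by
          rw [soScoreA, if_pos (by omega), if_pos (by omega)]
        rw [this]
        exact ih _ _ (by omega) (by omega) (by omega)
    · refine key _ _ i j le_rfl hi hj ?_
      have : soScoreA n i j srv = SOState.game (i + 1) j srv := by
        rw [soScoreA, if_neg (by omega), if_neg (by omega)]
      rw [this]
      exact ih _ _ (by omega) (by omega) (by omega)

lemma le_of_serve_A (hq : SOHarmonic n pA pB q) (hn : 1 ≤ n)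
    (hA : pA ∈ Set.Icc (0 : ℝ) 1) {m : ℝ} (hm : 0 ≤ m)
    (hqm : ∀ i j srv, i ≤ n → j ≤ n → q (SOState.game i j srv) ≤ m)
    {srv : SOSrv} (hsrv : srv = SOSrv.A1 ∨ srv = SOSrv.A2) {i j : ℕ} (hi : i ≤ n) (hj : j ≤ n) :
    q (SOState.game i j srv) ≤ (1 - pA ^ (n + 3)) * m :=
  hq.le_of_serve_A_of_points hn hA hm hqm hsrv (n + 2) i j hi hj (by omega)

lemma le_of_serve_B (hq : SOHarmonic n pA pB q) (hn : 1 ≤ n)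
    (hB : pB ∈ Set.Icc (0 : ℝ) 1) {m : ℝ} (hm : 0 ≤ m)
    (hqm : ∀ i j srv, i ≤ n → j ≤ n → q (SOState.game i j srv) ≤ m)
    {srv : SOSrv} (hsrv : srv = SOSrv.B1 ∨ srv = SOSrv.B2) {i j : ℕ} (hi : i ≤ n) (hj : j ≤ n) :
    q (SOState.game i j srv) ≤ (1 - pB ^ (n + 3)) * m := by
  have h := hq.swap.le_of_serve_A hn hB hm (fun i j srv hi hj => hqm j i srv.swap hj hi)
    (srv := srv.swap) (by rcases hsrv with rfl | rfl <;> simp [SOSrv.swap]) hj hi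
  rwa [Function.comp_apply, show SOState.game j i srv.swap = (SOState.game i j srv).swap from rfl,
    SOState.swap_swap] at h

lemma eq_next (hq : SOHarmonic n pA pB q) {srv : SOSrv} (h : srv.prob pA pB = 0) (i j : ℕ) :
    q (SOState.game i j srv) = q (SOState.game i j srv.next) := by
  rw [hq.game, h]
  ring

/-- Upper bounds on the scores of a game improve by a constant factor less than `1`. -/
lemma exists_contraction (hq : SOHarmonic n pA pB q) (hn : 1 ≤ n)
    (hA : pA ∈ Set.Icc (0 : ℝ) 1) (hB : pB ∈ Set.Icc (0 : ℝ) 1) (hpos : 0 < pA + pB) :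
    ∃ c : ℝ, 0 ≤ c ∧ c < 1 ∧ ∀ m : ℝ, 0 ≤ m →
      (∀ i j srv, i ≤ n → j ≤ n → q (SOState.game i j srv) ≤ m) →
      ∀ i j srv, i ≤ n → j ≤ n → q (SOState.game i j srv) ≤ c * m := by
  have hA1 : pA ^ (n + 3) ≤ 1 := pow_le_one₀ hA.1 hA.2
  have hB1 : pB ^ (n + 3) ≤ 1 := pow_le_one₀ hB.1 hB.2
  rcases hA.1.eq_or_lt with hA0 | hA0
  · refine ⟨1 - pB ^ (n + 3), by linarith,
      by linarith [pow_pos (show 0 < pB by linarith) (n + 3)], ?_⟩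
    intro m hm hqm i j srv hi hj
    have hB1 := hq.le_of_serve_B hn hB hm hqm (Or.inl rfl) hi hj
    have hA2 := (hq.eq_next (srv := SOSrv.A2) hA0.symm i j).trans_le hB1
    cases srv
    · exact (hq.eq_next (srv := SOSrv.A1) hA0.symm i j).trans_le hA2
    · exact hA2
    · exact hB1
    · exact hq.le_of_serve_B hn hB hm hqm (Or.inr rfl) hi hj
  rcases hB.1.eq_or_lt with hB0 | hB0
  · refine ⟨1 - pA ^ (n + 3), by linarith, by linarith [pow_pos hA0 (n + 3)], ?_⟩
    intro m hm hqm i j srv hi hj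
    have hA1 := hq.le_of_serve_A hn hA hm hqm (Or.inl rfl) hi hj
    have hB2 := (hq.eq_next (srv := SOSrv.B2) hB0.symm i j).trans_le hA1
    cases srv
    · exact hA1
    · exact hq.le_of_serve_A hn hA hm hqm (Or.inr rfl) hi hj
    · exact (hq.eq_next (srv := SOSrv.B1) hB0.symm i j).trans_le hB2
    · exact hB2
  · refine ⟨max (1 - pA ^ (n + 3)) (1 - pB ^ (n + 3)), le_max_of_le_left (by linarith),
      max_lt (by linarith [pow_pos hA0 (n + 3)]) (by linarith [pow_pos hB0 (n + 3)]), ?_⟩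
    intro m hm hqm i j srv hi hj
    have hmaxA := mul_le_mul_of_nonneg_right
      (le_max_left (1 - pA ^ (n + 3)) (1 - pB ^ (n + 3))) hm
    have hmaxB := mul_le_mul_of_nonneg_right
      (le_max_right (1 - pA ^ (n + 3)) (1 - pB ^ (n + 3))) hm
    cases srv
    · exact (hq.le_of_serve_A hn hA hm hqm (Or.inl rfl) hi hj).trans hmaxA
    · exact (hq.le_of_serve_A hn hA hm hqm (Or.inr rfl) hi hj).trans hmaxA
    · exact (hq.le_of_serve_B hn hB hm hqm (Or.inl rfl) hi hj).trans hmaxB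
    · exact (hq.le_of_serve_B hn hB hm hqm (Or.inr rfl) hi hj).trans hmaxB

lemma nonpos (hq : SOHarmonic n pA pB q) (hn : 1 ≤ n)
    (hA : pA ∈ Set.Icc (0 : ℝ) 1) (hB : pB ∈ Set.Icc (0 : ℝ) 1) (hpos : 0 < pA + pB)
    (hq1 : ∀ s, q s ≤ 1) {i j : ℕ} (srv : SOSrv) (hi : i ≤ n) (hj : j ≤ n) :
    q (SOState.game i j srv) ≤ 0 := by
  obtain ⟨c, hc0, hc1, hc⟩ := hq.exists_contraction hn hA hB hpos
  have hpow : ∀ k : ℕ, ∀ i j srv, i ≤ n → j ≤ n → q (SOState.game i j srv) ≤ c ^ k := by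
    intro k
    induction k with
    | zero => exact fun _ _ _ _ _ => (hq1 _).trans_eq (pow_zero c).symm
    | succ k ih =>
      rw [pow_succ']
      exact hc _ (pow_nonneg hc0 k) ih
  exact ge_of_tendsto' (tendsto_pow_atTop_nhds_zero_of_lt_one hc0 hc1)
    fun k => hpow k i j srv hi hj

end SOHarmonic

/-- The game ends almost surely. -/
lemma soWinA_add_soWinB {n : ℕ} (hn : 1 ≤ n) {pA pB : ℝ}
    (hA : pA ∈ Set.Icc (0 : ℝ) 1) (hB : pB ∈ Set.Icc (0 : ℝ) 1) (hpos : 0 < pA + pB)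
    {i j : ℕ} (srv : SOSrv) (hi : i ≤ n) (hj : j ≤ n) :
    soWinA n pA pB (SOState.game i j srv) + soWinB n pA pB (SOState.game i j srv) = 1 := by
  have hlim := fun s => (tendsto_soWinA (n := n) hA hB s).add (tendsto_soWinB hA hB s)
  refine le_antisymm
    (le_of_tendsto' (hlim _) fun k => soDist_Awins_add_Bwins_le_one hA hB k _)
    (sub_nonpos.1 ((soHarmonic_one_sub hA hB).nonpos hn hA hB hpos (fun s => ?_) srv hi hj))
  exact sub_le_self _ (ge_of_tendsto' (hlim s) fun k =>
    add_nonneg (soDist_nonneg hA hB k _ _) (soDist_nonneg hA hB k _ _))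

/-- For every integer `n ≥ 2` and all `p_A, p_B ∈ [0,1]` with
`p_A + p_B > 0`, the first-serving team's advantage under side-out scoring is a
symmetric function of the two rally-win probabilities. -/
theorem soAdv_symm (n : ℕ) (hn : 2 ≤ n) (pA pB : ℝ)
    (hA : pA ∈ Set.Icc (0 : ℝ) 1) (hB : pB ∈ Set.Icc (0 : ℝ) 1)
    (hpos : 0 < pA + pB) :
    soAdv n pA pB = soAdv n pB pA := by
  have hA2 := soWinA_add_soWinB (by omega) hA hB hpos SOSrv.A2 n.zero_le n.zero_le
  have hB2 := soWinA_add_soWinB (by omega) hA hB hpos SOSrv.B2 n.zero_le n.zero_le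
  have hswapA := soWinA_swap n pA pB (SOState.game 0 0 SOSrv.A2)
  have hswapB := soWinA_swap n pA pB (SOState.game 0 0 SOSrv.B2)
  simp only [SOState.swap, SOSrv.swap] at hswapA hswapB
  unfold soAdv
  rw [hswapA, hswapB]
  linarith
end

section
/- For every integer n ≥ 4 there exist real polynomials P and Q in two variables such that for every (p_A, p_B) ∈ [0,1]×[0,1] with p_A + p_B > 0, Q(p_A, p_B) ≠ 0 and f*_n(p_A, p_B) = P(p_A, p_B)/Q(p_A, p_B); that is, the first-serving team's advantage under modified rally scoring is a rational function of (p_A, p_B) on [0,1]×[0,1] minus the origin. -/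
/-- The serving team in modified rally scoring. -/
inductive MRSrv : Type
  | A | B
  deriving DecidableEq

/-- States of a modified rally scoring game to `n`: a (capped) score `(i, j)` together
with the serving team, or one of the two absorbing states. -/
inductive MRState (n : ℕ) : Type
  | game (i j : ℕ) (srv : MRSrv)
  | Awins
  | Bwins
  deriving DecidableEq

/-- Result of Team A scoring a point from (capped) score `(i, j)`; Team A serves next. -/
def mrScoreA (n i j : ℕ) : MRState n :=
  if i = n - 1 then
    if j = n - 1 then MRState.game n (n - 1) MRSrv.A
    else if j = n then MRState.game (n - 1) (n - 1) MRSrv.A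
    else MRState.Awins
  else if i = n then MRState.Awins
  else MRState.game (i + 1) j MRSrv.A

/-- Result of Team B scoring a point from (capped) score `(i, j)`; Team B serves next. -/
def mrScoreB (n i j : ℕ) : MRState n :=
  if j = n - 1 then
    if i = n - 1 then MRState.game (n - 1) n MRSrv.B
    else if i = n then MRState.game (n - 1) (n - 1) MRSrv.B
    else MRState.Bwins
  else if j = n then MRState.Bwins
  else MRState.game i (j + 1) MRSrv.B

/-- Under modified-rally point awarding, whether Team A, winning a rally as the
*receiving* team at capped score `(i, j)`, is awarded a point: it must not yet have
reached `n - 1` points, and it must not be the case that the opponent has reached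
`n - 1` points while Team A has reached `n - 3` points. -/
def canRecvScoreA (n i j : ℕ) : Prop := i < n - 1 ∧ ¬(n - 1 ≤ j ∧ n - 3 ≤ i)

/-- Whether Team B, winning a rally as the receiving team at capped score `(i, j)`,
is awarded a point. -/
def canRecvScoreB (n i j : ℕ) : Prop := j < n - 1 ∧ ¬(n - 1 ≤ i ∧ n - 3 ≤ j)

instance (n i j : ℕ) : Decidable (canRecvScoreA n i j) := by
  unfold canRecvScoreA; infer_instance

instance (n i j : ℕ) : Decidable (canRecvScoreB n i j) := by
  unfold canRecvScoreB; infer_instance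

/-- `mrDist n pA pB k s t` : the probability that a modified rally scoring game to `n`
is in state `t` after `k` rallies, starting from state `s`.  The serving team wins the
rally with probability `pA` (resp. `pB`); the winner of the rally serves next; the
winner always scores when it was serving, and scores when it was receiving exactly
when permitted by the modified-rally rules. The absorbing states stay put. -/
def mrDist (n : ℕ) (pA pB : ℝ) : ℕ → MRState n → MRState n → ℝ
  | 0, s, t => if t = s then 1 else 0
  | k + 1, MRState.Awins, t => mrDist n pA pB k MRState.Awins t
  | k + 1, MRState.Bwins, t => mrDist n pA pB k MRState.Bwins t
  | k + 1, MRState.game i j MRSrv.A, t =>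
      pA * mrDist n pA pB k (mrScoreA n i j) t
        + (1 - pA) * mrDist n pA pB k
            (if canRecvScoreB n i j then mrScoreB n i j else MRState.game i j MRSrv.B) t
  | k + 1, MRState.game i j MRSrv.B, t =>
      pB * mrDist n pA pB k (mrScoreB n i j) t
        + (1 - pB) * mrDist n pA pB k
            (if canRecvScoreA n i j then mrScoreA n i j else MRState.game i j MRSrv.A) t

/-- Probability that Team A eventually wins the modified rally scoring game, from `s`. -/
noncomputable def mrWinA (n : ℕ) (pA pB : ℝ) (s : MRState n) : ℝ :=
  ⨆ k : ℕ, mrDist n pA pB k s MRState.Awins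

/-- Probability that Team B eventually wins the modified rally scoring game, from `s`. -/
noncomputable def mrWinB (n : ℕ) (pA pB : ℝ) (s : MRState n) : ℝ :=
  ⨆ k : ℕ, mrDist n pA pB k s MRState.Bwins

/-- The first-serving team's advantage `f*_n(p_A, p_B)` under modified rally scoring:
P(Team A wins | Team A serves first) − P(Team A wins | Team B serves first). -/
noncomputable def mrAdv (n : ℕ) (pA pB : ℝ) : ℝ :=
  mrWinA n pA pB (MRState.game 0 0 MRSrv.A) - mrWinA n pA pB (MRState.game 0 0 MRSrv.B)

/-- Serve-winning probabilities in the unit square minus the origin. -/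
def MRAdmissible (pA pB : ℝ) : Prop :=
  pA ∈ Set.Icc (0 : ℝ) 1 ∧ pB ∈ Set.Icc (0 : ℝ) 1 ∧ 0 < pA + pB

/-- `f` agrees with a quotient of polynomials, with nonvanishing denominator, at all admissible
parameters. -/
def IsMRRational (f : ℝ → ℝ → ℝ) : Prop :=
  ∃ P Q : MvPolynomial (Fin 2) ℝ, ∀ pA pB : ℝ, MRAdmissible pA pB →
    MvPolynomial.eval ![pA, pB] Q ≠ 0 ∧
      f pA pB = MvPolynomial.eval ![pA, pB] P / MvPolynomial.eval ![pA, pB] Q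

namespace IsMRRational

variable {f g e h u v : ℝ → ℝ → ℝ}

theorem congr (hf : IsMRRational f) (hfg : ∀ pA pB, MRAdmissible pA pB → g pA pB = f pA pB) :
    IsMRRational g := by
  obtain ⟨P, Q, hPQ⟩ := hf
  exact ⟨P, Q, fun a b hab => ⟨(hPQ a b hab).1, (hfg a b hab).trans (hPQ a b hab).2⟩⟩

theorem const (c : ℝ) : IsMRRational fun _ _ => c :=
  ⟨MvPolynomial.C c, 1, fun _ _ _ => by simp⟩

theorem fst : IsMRRational fun pA _ => pA :=
  ⟨MvPolynomial.X 0, 1, fun _ _ _ => by simp⟩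

theorem snd : IsMRRational fun _ pB => pB :=
  ⟨MvPolynomial.X 1, 1, fun _ _ _ => by simp⟩

theorem add (hf : IsMRRational f) (hg : IsMRRational g) :
    IsMRRational fun a b => f a b + g a b := by
  obtain ⟨P, Q, hPQ⟩ := hf
  obtain ⟨R, S, hRS⟩ := hg
  refine ⟨P * S + Q * R, Q * S, fun a b hab => ?_⟩
  obtain ⟨hQ, hf⟩ := hPQ a b hab
  obtain ⟨hS, hg⟩ := hRS a b hab
  simp only [map_mul, map_add]
  exact ⟨mul_ne_zero hQ hS, by rw [hf, hg, div_add_div _ _ hQ hS]⟩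

theorem mul (hf : IsMRRational f) (hg : IsMRRational g) :
    IsMRRational fun a b => f a b * g a b := by
  obtain ⟨P, Q, hPQ⟩ := hf
  obtain ⟨R, S, hRS⟩ := hg
  refine ⟨P * R, Q * S, fun a b hab => ?_⟩
  obtain ⟨hQ, hf⟩ := hPQ a b hab
  obtain ⟨hS, hg⟩ := hRS a b hab
  simp only [map_mul]
  exact ⟨mul_ne_zero hQ hS, by rw [hf, hg, div_mul_div_comm]⟩

theorem sub (hf : IsMRRational f) (hg : IsMRRational g) :
    IsMRRational fun a b => f a b - g a b :=
  (hf.add ((const (-1)).mul hg)).congr fun _ _ _ => by ring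

theorem div (hf : IsMRRational f) (hg : IsMRRational g)
    (hne : ∀ a b, MRAdmissible a b → g a b ≠ 0) :
    IsMRRational fun a b => f a b / g a b := by
  obtain ⟨P, Q, hPQ⟩ := hf
  obtain ⟨R, S, hRS⟩ := hg
  refine ⟨P * S, Q * R, fun a b hab => ?_⟩
  obtain ⟨hQ, hf⟩ := hPQ a b hab
  obtain ⟨hS, hg⟩ := hRS a b hab
  have hR : MvPolynomial.eval ![a, b] R ≠ 0 := by
    intro h0
    exact hne a b hab (by rw [hg, h0, zero_div])
  simp only [map_mul]
  exact ⟨mul_ne_zero hQ hR, by rw [hf, hg, div_div_div_eq]⟩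

/-- The solutions of a nonsingular system `u = e + f v`, `v = g + h u` with rational
coefficients are rational. -/
theorem solve (he : IsMRRational e) (hf : IsMRRational f) (hg : IsMRRational g)
    (hh : IsMRRational h)
    (hdet : ∀ a b, MRAdmissible a b → 1 - f a b * h a b ≠ 0)
    (hu : ∀ a b, MRAdmissible a b → u a b = e a b + f a b * v a b)
    (hv : ∀ a b, MRAdmissible a b → v a b = g a b + h a b * u a b) :
    IsMRRational u ∧ IsMRRational v := by
  have hur : IsMRRational u := by
    refine ((he.add (hf.mul hg)).div ((const 1).sub (hf.mul hh)) hdet).congr fun a b hab => ?_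
    rw [eq_div_iff (hdet a b hab)]
    linear_combination hu a b hab + f a b * hv a b hab
  exact ⟨hur, (hg.add (hh.mul hur)).congr hv⟩

end IsMRRational

namespace MRAdmissible

variable {a b : ℝ}

theorem one_sub_mul_pos (h : MRAdmissible a b) : 0 < 1 - (1 - a) * (1 - b) := by
  obtain ⟨⟨ha, ha1⟩, ⟨hb, hb1⟩, hab⟩ := h
  rcases ha.eq_or_lt with rfl | ha
  · linarith
  · nlinarith [mul_nonneg hb (sub_nonneg.2 ha1)]

theorem mul_le_deuce_coeff (h : MRAdmissible a b) :
    a * b ≤ (1 - (1 - a) * (1 - b)) ^ 2 - (1 - a) * (1 - b) * (a * b) := by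
  obtain ⟨⟨ha, ha1⟩, ⟨hb, hb1⟩, -⟩ := h
  nlinarith [mul_nonneg (sq_nonneg a) (sub_nonneg.2 hb1),
    mul_nonneg (sq_nonneg b) (sub_nonneg.2 ha1)]

theorem deuce_coeff_pos (h : MRAdmissible a b) :
    0 < (1 - (1 - a) * (1 - b)) ^ 2 - (1 - a) * (1 - b) * (a * b) := by
  have hm : 0 ≤ a * b := mul_nonneg h.1.1 h.2.1.1
  rcases hm.eq_or_lt with hm | hm
  · rw [← hm, mul_zero, sub_zero]
    exact pow_pos h.one_sub_mul_pos 2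
  · exact hm.trans_le h.mul_le_deuce_coeff

theorem deuce_det_pos (h : MRAdmissible a b) :
    0 < ((1 - (1 - a) * (1 - b)) ^ 2 - (1 - a) * (1 - b) * (a * b)) ^ 2
      - (a * (1 - a) * b) * (a * b * (1 - b)) := by
  have hm : 0 ≤ a * b := mul_nonneg h.1.1 h.2.1.1
  have hK := h.mul_le_deuce_coeff
  have hK0 := h.deuce_coeff_pos
  have hD := h.one_sub_mul_pos
  set K := (1 - (1 - a) * (1 - b)) ^ 2 - (1 - a) * (1 - b) * (a * b)
  have hsq : (a * b) ^ 2 ≤ K ^ 2 := pow_le_pow_left₀ hm hK 2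
  rcases hm.eq_or_lt with hm | hm
  · have : (a * (1 - a) * b) * (a * b * (1 - b)) = (a * b) ^ 2 * ((1 - a) * (1 - b)) := by ring
    rw [this, ← hm]
    simpa using pow_pos hK0 2
  · nlinarith [mul_pos (pow_pos hm 2) hD]

end MRAdmissible

section Dynamics

variable {n : ℕ} {pA pB : ℝ}

theorem mrDist_mem_Icc (hA : pA ∈ Set.Icc (0 : ℝ) 1) (hB : pB ∈ Set.Icc (0 : ℝ) 1) (k : ℕ)
    (s t : MRState n) : mrDist n pA pB k s t ∈ Set.Icc (0 : ℝ) 1 := by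
  have convex_comb {p x y : ℝ} (hp : p ∈ Set.Icc (0 : ℝ) 1) (hx : x ∈ Set.Icc (0 : ℝ) 1)
      (hy : y ∈ Set.Icc (0 : ℝ) 1) : p * x + (1 - p) * y ∈ Set.Icc (0 : ℝ) 1 :=
    convex_Icc (0 : ℝ) 1 hx hy hp.1 (sub_nonneg.2 hp.2) (by ring)
  induction k generalizing s with
  | zero => rw [mrDist]; split_ifs <;> simp
  | succ k ih =>
    rcases s with ⟨i, j, _ | _⟩ | _ | _
    · exact convex_comb hA (ih _) (ih _)
    · exact convex_comb hB (ih _) (ih _)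
    · exact ih _
    · exact ih _

theorem mrDist_Awins_le_succ (hA : pA ∈ Set.Icc (0 : ℝ) 1) (hB : pB ∈ Set.Icc (0 : ℝ) 1) (k : ℕ)
    (s : MRState n) :
    mrDist n pA pB k s MRState.Awins ≤ mrDist n pA pB (k + 1) s MRState.Awins := by
  induction k generalizing s with
  | zero =>
    rcases s with ⟨i, j, srv⟩ | _ | _
    · rw [mrDist, if_neg (by simp)]
      exact (mrDist_mem_Icc hA hB _ _ _).1
    · exact le_rfl
    · exact le_rfl
  | succ k ih =>
    rcases s with ⟨i, j, _ | _⟩ | _ | _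
    · exact add_le_add (mul_le_mul_of_nonneg_left (ih _) hA.1)
        (mul_le_mul_of_nonneg_left (ih _) (sub_nonneg.2 hA.2))
    · exact add_le_add (mul_le_mul_of_nonneg_left (ih _) hB.1)
        (mul_le_mul_of_nonneg_left (ih _) (sub_nonneg.2 hB.2))
    · exact ih _
    · exact ih _

theorem tendsto_mrDist_mrWinA (hA : pA ∈ Set.Icc (0 : ℝ) 1) (hB : pB ∈ Set.Icc (0 : ℝ) 1)
    (s : MRState n) :
    Filter.Tendsto (fun k => mrDist n pA pB k s MRState.Awins) Filter.atTop
      (nhds (mrWinA n pA pB s)) :=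
  tendsto_atTop_ciSup (monotone_nat_of_le_succ fun k => mrDist_Awins_le_succ hA hB k s)
    ⟨1, by rintro _ ⟨k, rfl⟩; exact (mrDist_mem_Icc hA hB k s _).2⟩

theorem mrWinA_Awins : mrWinA n pA pB MRState.Awins = 1 := by
  have h (k : ℕ) : mrDist n pA pB k MRState.Awins MRState.Awins = 1 := by
    induction k with
    | zero => exact if_pos rfl
    | succ k ih => exact ih
  simp [mrWinA, h]

theorem mrWinA_Bwins : mrWinA n pA pB MRState.Bwins = 0 := by
  have h (k : ℕ) : mrDist n pA pB k MRState.Bwins MRState.Awins = 0 := by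
    induction k with
    | zero => exact if_neg (by simp)
    | succ k ih => exact ih
  simp [mrWinA, h]

theorem mrWinA_game_A (hA : pA ∈ Set.Icc (0 : ℝ) 1) (hB : pB ∈ Set.Icc (0 : ℝ) 1) (i j : ℕ) :
    mrWinA n pA pB (MRState.game i j MRSrv.A) =
      pA * mrWinA n pA pB (mrScoreA n i j) + (1 - pA) * mrWinA n pA pB
        (if canRecvScoreB n i j then mrScoreB n i j else MRState.game i j MRSrv.B) :=
  tendsto_nhds_unique
    ((Filter.tendsto_add_atTop_iff_nat 1).2
      (tendsto_mrDist_mrWinA hA hB (MRState.game i j MRSrv.A)))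
    (((tendsto_mrDist_mrWinA hA hB _).const_mul pA).add
      ((tendsto_mrDist_mrWinA hA hB _).const_mul (1 - pA)))

theorem mrWinA_game_B (hA : pA ∈ Set.Icc (0 : ℝ) 1) (hB : pB ∈ Set.Icc (0 : ℝ) 1) (i j : ℕ) :
    mrWinA n pA pB (MRState.game i j MRSrv.B) =
      pB * mrWinA n pA pB (mrScoreB n i j) + (1 - pB) * mrWinA n pA pB
        (if canRecvScoreA n i j then mrScoreA n i j else MRState.game i j MRSrv.A) :=
  tendsto_nhds_unique
    ((Filter.tendsto_add_atTop_iff_nat 1).2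
      (tendsto_mrDist_mrWinA hA hB (MRState.game i j MRSrv.B)))
    (((tendsto_mrDist_mrWinA hA hB _).const_mul pB).add
      ((tendsto_mrDist_mrWinA hA hB _).const_mul (1 - pB)))

end Dynamics

/-- Team A's winning probability from `s` is a rational function of the parameters. -/
def MRWinRational (n : ℕ) (s : MRState n) : Prop :=
  IsMRRational fun pA pB => mrWinA n pA pB s

open IsMRRational in
theorem MRWinRational.game_of_scores {n i j : ℕ} (hS : MRWinRational n (mrScoreA n i j))
    (hT : MRWinRational n (mrScoreB n i j)) :
    MRWinRational n (MRState.game i j MRSrv.A) ∧ MRWinRational n (MRState.game i j MRSrv.B) := by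
  have hqA : IsMRRational fun pA _ => 1 - pA := (const 1).sub fst
  have hqB : IsMRRational fun _ pB => 1 - pB := (const 1).sub snd
  have eqA (a b) (h : MRAdmissible a b) := mrWinA_game_A (n := n) h.1 h.2.1 i j
  have eqB (a b) (h : MRAdmissible a b) := mrWinA_game_B (n := n) h.1 h.2.1 i j
  by_cases cB : canRecvScoreB n i j
  · simp only [if_pos cB] at eqA
    have hVA : MRWinRational n (MRState.game i j MRSrv.A) :=
      ((fst.mul hS).add (hqA.mul hT)).congr eqA
    refine ⟨hVA, ?_⟩
    by_cases cA : canRecvScoreA n i j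
    · simp only [if_pos cA] at eqB
      exact ((snd.mul hT).add (hqB.mul hS)).congr eqB
    · simp only [if_neg cA] at eqB
      exact ((snd.mul hT).add (hqB.mul hVA)).congr eqB
  · simp only [if_neg cB] at eqA
    by_cases cA : canRecvScoreA n i j
    · simp only [if_pos cA] at eqB
      have hVB : MRWinRational n (MRState.game i j MRSrv.B) :=
        ((snd.mul hT).add (hqB.mul hS)).congr eqB
      exact ⟨((fst.mul hS).add (hqA.mul hVB)).congr eqA, hVB⟩
    · simp only [if_neg cA] at eqB
      exact solve (fst.mul hS) hqA (snd.mul hT) hqB (fun a b h => h.one_sub_mul_pos.ne') eqA eqB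

open IsMRRational in
theorem mrWinRational_deuce {n : ℕ} (hn : 1 ≤ n) :
    MRWinRational n (MRState.game (n - 1) (n - 1) MRSrv.A) ∧
      MRWinRational n (MRState.game (n - 1) (n - 1) MRSrv.B) := by
  have hne : n ≠ n - 1 := by omega
  have hqA : IsMRRational fun pA _ => 1 - pA := (const 1).sub fst
  have hqB : IsMRRational fun _ pB => 1 - pB := (const 1).sub snd
  have hqq : IsMRRational fun pA pB => (1 - pA) * (1 - pB) := hqA.mul hqB
  have hD : IsMRRational fun pA pB => 1 - (1 - pA) * (1 - pB) := (const 1).sub hqq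
  have hK : IsMRRational fun a b =>
      (1 - (1 - a) * (1 - b)) ^ 2 - (1 - a) * (1 - b) * (a * b) :=
    ((hD.mul hD).sub (hqq.mul (fst.mul snd))).congr fun _ _ _ => by ring
  have hKne (a b) (h : MRAdmissible a b) := h.deuce_coeff_pos.ne'
  have eqs (a b) (h : MRAdmissible a b) :
      mrWinA n a b (.game (n - 1) (n - 1) .A) *
          ((1 - (1 - a) * (1 - b)) ^ 2 - (1 - a) * (1 - b) * (a * b)) =
        a * a + a * (1 - a) * b * mrWinA n a b (.game (n - 1) (n - 1) .B) ∧
      mrWinA n a b (.game (n - 1) (n - 1) .B) *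
          ((1 - (1 - a) * (1 - b)) ^ 2 - (1 - a) * (1 - b) * (a * b)) =
        (1 - b) * (a * a) + a * b * (1 - b) * mrWinA n a b (.game (n - 1) (n - 1) .A) := by
    have hxA := mrWinA_game_A (n := n) h.1 h.2.1 (n - 1) (n - 1)
    have hxB := mrWinA_game_B (n := n) h.1 h.2.1 (n - 1) (n - 1)
    have hSA := mrWinA_game_A (n := n) h.1 h.2.1 n (n - 1)
    have hSB := mrWinA_game_B (n := n) h.1 h.2.1 n (n - 1)
    have hTA := mrWinA_game_A (n := n) h.1 h.2.1 (n - 1) n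
    have hTB := mrWinA_game_B (n := n) h.1 h.2.1 (n - 1) n
    simp only [mrScoreA, mrScoreB, canRecvScoreA, canRecvScoreB, lt_irrefl, false_and, if_true,
      if_false, hne, show ¬ n < n - 1 by omega, mrWinA_Awins, mrWinA_Bwins]
      at hxA hxB hSA hSB hTA hTB
    generalize mrWinA n a b (.game (n - 1) (n - 1) .A) = x at *
    generalize mrWinA n a b (.game (n - 1) (n - 1) .B) = y at *
    generalize mrWinA n a b (.game n (n - 1) .A) = S at *
    generalize mrWinA n a b (.game n (n - 1) .B) = S' at *
    generalize mrWinA n a b (.game (n - 1) n .B) = T at *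
    generalize mrWinA n a b (.game (n - 1) n .A) = T' at *
    have hS : S * (1 - (1 - a) * (1 - b)) = a + (1 - a) * b * y := by
      linear_combination hSA + (1 - a) * hSB
    have hT : T * (1 - (1 - a) * (1 - b)) = (1 - b) * a * x := by
      linear_combination hTB + (1 - b) * hTA
    have hx : x * (1 - (1 - a) * (1 - b)) = a * S + (1 - a) * b * T := by
      linear_combination hxA + (1 - a) * hxB
    have hy : y * (1 - (1 - a) * (1 - b)) = b * T + (1 - b) * a * S := by
      linear_combination hxB + (1 - b) * hxA
    constructor
    · linear_combination (1 - (1 - a) * (1 - b)) * hx + a * hS + (1 - a) * b * hT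
    · linear_combination (1 - (1 - a) * (1 - b)) * hy + b * hT + (1 - b) * a * hS
  refine solve ((fst.mul fst).div hK hKne) (((fst.mul hqA).mul snd).div hK hKne)
    ((hqB.mul (fst.mul fst)).div hK hKne) (((fst.mul snd).mul hqB).div hK hKne)
    (fun a b h => ?_) (fun a b h => ?_) (fun a b h => ?_)
  · have hdet := h.deuce_det_pos.ne'
    rw [div_mul_div_comm, one_sub_div (mul_ne_zero (hKne a b h) (hKne a b h)), ← pow_two]
    exact div_ne_zero hdet (pow_ne_zero 2 (hKne a b h))
  · rw [div_mul_eq_mul_div, ← add_div, eq_div_iff (hKne a b h)]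
    exact (eqs a b h).1
  · rw [div_mul_eq_mul_div, ← add_div, eq_div_iff (hKne a b h)]
    exact (eqs a b h).2

theorem mrWinRational_game {n : ℕ} (hn : 1 ≤ n) {i j : ℕ} (hi : i ≤ n - 1) (hj : j ≤ n - 1) :
    MRWinRational n (MRState.game i j MRSrv.A) ∧ MRWinRational n (MRState.game i j MRSrv.B) := by
  by_cases hdeuce : i = n - 1 ∧ j = n - 1
  · obtain ⟨rfl, rfl⟩ := hdeuce
    exact mrWinRational_deuce hn
  · apply MRWinRational.game_of_scores
    · by_cases hi' : i = n - 1
      · rw [mrScoreA, if_pos hi', if_neg (fun h => hdeuce ⟨hi', h⟩), if_neg (by omega)]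
        exact (IsMRRational.const 1).congr fun _ _ _ => mrWinA_Awins
      · rw [mrScoreA, if_neg hi', if_neg (by omega)]
        exact (mrWinRational_game hn (by omega) hj).1
    · by_cases hj' : j = n - 1
      · rw [mrScoreB, if_pos hj', if_neg (fun h => hdeuce ⟨h, hj'⟩), if_neg (by omega)]
        exact (IsMRRational.const 0).congr fun _ _ _ => mrWinA_Bwins
      · rw [mrScoreB, if_neg hj', if_neg (by omega)]
        exact (mrWinRational_game hn hi (by omega)).2
termination_by (n - 1 - i) + (n - 1 - j)

/-- For every integer `n ≥ 4`, the first-serving team's advantage under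
modified rally scoring is a rational function of `(p_A, p_B)` on `[0,1] × [0,1]` minus
the origin. -/
theorem mrAdv_rational (n : ℕ) (hn : 4 ≤ n) :
    ∃ P Q : MvPolynomial (Fin 2) ℝ,
      ∀ pA pB : ℝ, pA ∈ Set.Icc (0 : ℝ) 1 → pB ∈ Set.Icc (0 : ℝ) 1 → 0 < pA + pB →
        MvPolynomial.eval ![pA, pB] Q ≠ 0 ∧
          mrAdv n pA pB =
            MvPolynomial.eval ![pA, pB] P / MvPolynomial.eval ![pA, pB] Q := by
  have hgame := mrWinRational_game (n := n) (by omega) (Nat.zero_le _) (Nat.zero_le _)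
  obtain ⟨P, Q, hPQ⟩ := hgame.1.sub hgame.2
  exact ⟨P, Q, fun pA pB hA hB hAB => hPQ pA pB ⟨hA, hB, hAB⟩⟩
end

section
/- For every integer n ≥ 4 and all p_A, p_B ∈ [0,1] with p_A + p_B > 0, the first-serving team's advantage under hybrid rally scoring is a symmetric function of the two rally-win probabilities: f°_n(p_A, p_B) = f°_n(p_B, p_A). -/
/-- `hyDist n pA pB k s t` : the probability that a hybrid rally scoring game to `n`
is in state `t` after `k` rallies, starting from state `s`.  Serve rotation is as in
side-out scoring: the serving team wins the rally with probability `pA` (resp. `pB`),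
in which case it scores a point and keeps the server; otherwise the server designation
advances `A1 → A2 → B1 → B2 → A1` and the receiving team, which won the rally, scores
a point exactly when permitted by the modified-rally rules.  The absorbing states
stay put. -/
def hyDist (n : ℕ) (pA pB : ℝ) : ℕ → SOState n → SOState n → ℝ
  | 0, s, t => if t = s then 1 else 0
  | k + 1, SOState.Awins, t => hyDist n pA pB k SOState.Awins t
  | k + 1, SOState.Bwins, t => hyDist n pA pB k SOState.Bwins t
  | k + 1, SOState.game i j SOSrv.A1, t =>
      pA * hyDist n pA pB k (soScoreA n i j SOSrv.A1) t
        + (1 - pA) * hyDist n pA pB k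
            (if canRecvScoreB n i j then soScoreB n i j SOSrv.A2
             else SOState.game i j SOSrv.A2) t
  | k + 1, SOState.game i j SOSrv.A2, t =>
      pA * hyDist n pA pB k (soScoreA n i j SOSrv.A2) t
        + (1 - pA) * hyDist n pA pB k
            (if canRecvScoreB n i j then soScoreB n i j SOSrv.B1
             else SOState.game i j SOSrv.B1) t
  | k + 1, SOState.game i j SOSrv.B1, t =>
      pB * hyDist n pA pB k (soScoreB n i j SOSrv.B1) t
        + (1 - pB) * hyDist n pA pB k
            (if canRecvScoreA n i j then soScoreA n i j SOSrv.B2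
             else SOState.game i j SOSrv.B2) t
  | k + 1, SOState.game i j SOSrv.B2, t =>
      pB * hyDist n pA pB k (soScoreB n i j SOSrv.B2) t
        + (1 - pB) * hyDist n pA pB k
            (if canRecvScoreA n i j then soScoreA n i j SOSrv.A1
             else SOState.game i j SOSrv.A1) t

/-- Probability that Team A eventually wins the hybrid rally scoring game, from `s`. -/
noncomputable def hyWinA (n : ℕ) (pA pB : ℝ) (s : SOState n) : ℝ :=
  ⨆ k : ℕ, hyDist n pA pB k s SOState.Awins

/-- Probability that Team B eventually wins the hybrid rally scoring game, from `s`. -/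
noncomputable def hyWinB (n : ℕ) (pA pB : ℝ) (s : SOState n) : ℝ :=
  ⨆ k : ℕ, hyDist n pA pB k s SOState.Bwins

/-- The first-serving team's advantage `f°_n(p_A, p_B)` under hybrid rally scoring:
P(Team A wins | Team A serves first) − P(Team A wins | Team B serves first).
The game starts at score 0-0 with the first-serving team's second server. -/
noncomputable def hyAdv (n : ℕ) (pA pB : ℝ) : ℝ :=
  hyWinA n pA pB (SOState.game 0 0 SOSrv.A2) - hyWinA n pA pB (SOState.game 0 0 SOSrv.B2)

namespace SOSrv

/-- Exchange the roles of the two teams. -/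
def swap_s10 : SOSrv → SOSrv
  | A1 => B1
  | A2 => B2
  | B1 => A1
  | B2 => A2

/-- The next server designation after a rally lost on serve. -/
def next_s10 : SOSrv → SOSrv
  | A1 => A2
  | A2 => B1
  | B1 => B2
  | B2 => A1

/-- The probability that the serving team wins the rally. -/
def winProb (pA pB : ℝ) : SOSrv → ℝ
  | A1 | A2 => pA
  | B1 | B2 => pB

/-- The state reached when the serving team wins the rally. -/
def winState (n i j : ℕ) : SOSrv → SOState n
  | A1 => soScoreA n i j A1
  | A2 => soScoreA n i j A2
  | B1 => soScoreB n i j B1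
  | B2 => soScoreB n i j B2

/-- The state reached when the serving team loses the rally. -/
def loseState (n i j : ℕ) : SOSrv → SOState n
  | A1 => if canRecvScoreB n i j then soScoreB n i j A2 else SOState.game i j A2
  | A2 => if canRecvScoreB n i j then soScoreB n i j B1 else SOState.game i j B1
  | B1 => if canRecvScoreA n i j then soScoreA n i j B2 else SOState.game i j B2
  | B2 => if canRecvScoreA n i j then soScoreA n i j A1 else SOState.game i j A1

lemma winProb_mem_Icc {pA pB : ℝ} (hA : pA ∈ Set.Icc (0 : ℝ) 1) (hB : pB ∈ Set.Icc (0 : ℝ) 1)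
    (σ : SOSrv) : σ.winProb pA pB ∈ Set.Icc (0 : ℝ) 1 := by
  cases σ <;> assumption

lemma winProb_swap (pA pB : ℝ) (σ : SOSrv) : σ.swap_s10.winProb pA pB = σ.winProb pB pA := by
  cases σ <;> rfl

end SOSrv

namespace SOState

variable {n : ℕ}

/-- Exchange the roles of the two teams. -/
def swap_s10 : SOState n → SOState n
  | game i j σ => game j i σ.swap_s10
  | Awins => Bwins
  | Bwins => Awins

/-- Both scores are at most `n` (absorbing states count as bounded). -/
def Bounded : SOState n → Prop
  | game i j _ => i ≤ n ∧ j ≤ n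
  | _ => True

lemma swap_swap_s10 (s : SOState n) : s.swap_s10.swap_s10 = s := by
  rcases s with ⟨i, j, σ⟩ | _ | _
  · cases σ <;> rfl
  · rfl
  · rfl

lemma swap_inj {s t : SOState n} : s.swap_s10 = t.swap_s10 ↔ s = t :=
  ⟨fun h => by rw [← swap_swap_s10 s, h, swap_swap_s10], fun h => by rw [h]⟩

end SOState

lemma swap_soScoreA (n i j : ℕ) (σ : SOSrv) :
    (soScoreA n i j σ).swap_s10 = soScoreB n j i σ.swap_s10 := by
  unfold soScoreA soScoreB
  split_ifs <;> rfl

lemma swap_soScoreB (n i j : ℕ) (σ : SOSrv) :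
    (soScoreB n i j σ).swap_s10 = soScoreA n j i σ.swap_s10 := by
  unfold soScoreA soScoreB
  split_ifs <;> rfl

lemma SOSrv.winState_swap (n i j : ℕ) (σ : SOSrv) :
    σ.swap_s10.winState n j i = (σ.winState n i j).swap_s10 := by
  cases σ <;> simp [winState, swap_s10, swap_soScoreA, swap_soScoreB]

lemma SOSrv.loseState_swap (n i j : ℕ) (σ : SOSrv) :
    σ.swap_s10.loseState n j i = (σ.loseState n i j).swap_s10 := by
  cases σ <;>
    simp [loseState, swap_s10, canRecvScoreA, canRecvScoreB, apply_ite SOState.swap_s10,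
      swap_soScoreA, swap_soScoreB] <;> rfl

lemma bounded_soScoreA {n i j : ℕ} (hi : i ≤ n) (hj : j ≤ n) (σ : SOSrv) :
    (soScoreA n i j σ).Bounded := by
  unfold soScoreA
  split_ifs <;> simp only [SOState.Bounded] <;> omega

lemma bounded_soScoreB {n i j : ℕ} (hi : i ≤ n) (hj : j ≤ n) (σ : SOSrv) :
    (soScoreB n i j σ).Bounded := by
  unfold soScoreB
  split_ifs <;> simp only [SOState.Bounded] <;> omega

lemma SOSrv.bounded_winState {n i j : ℕ} (hi : i ≤ n) (hj : j ≤ n) (σ : SOSrv) :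
    (σ.winState n i j).Bounded := by
  cases σ
  exacts [bounded_soScoreA hi hj _, bounded_soScoreA hi hj _,
    bounded_soScoreB hi hj _, bounded_soScoreB hi hj _]

lemma SOSrv.bounded_loseState {n i j : ℕ} (hi : i ≤ n) (hj : j ≤ n) (σ : SOSrv) :
    (σ.loseState n i j).Bounded := by
  cases σ <;> unfold loseState <;> dsimp only <;> split_ifs <;>
    first
    | exact bounded_soScoreA hi hj _
    | exact bounded_soScoreB hi hj _
    | exact ⟨hi, hj⟩

/-- Losing a rally on serve either ends the game or passes the serve on. -/
lemma SOSrv.loseState_cases {n i j : ℕ} (hi : i ≤ n) (hj : j ≤ n) (σ : SOSrv) :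
    σ.loseState n i j = SOState.Awins ∨ σ.loseState n i j = SOState.Bwins ∨
      ∃ i' j', i' ≤ n ∧ j' ≤ n ∧ σ.loseState n i j = SOState.game i' j' σ.next_s10 := by
  have hb := σ.bounded_loseState hi hj
  have hsrv : ∀ i' j' τ, σ.loseState n i j = SOState.game i' j' τ → τ = σ.next_s10 := by
    intro i' j' τ h
    cases σ <;> simp only [loseState, soScoreA, soScoreB] at h <;> split_ifs at h <;>
      simp_all [next_s10]
  rcases h : σ.loseState n i j with ⟨i', j', τ⟩ | _ | _
  · rw [h] at hb
    obtain rfl := hsrv _ _ _ h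
    exact Or.inr (Or.inr ⟨i', j', hb.1, hb.2, rfl⟩)
  · exact Or.inl rfl
  · exact Or.inr (Or.inl rfl)

/-- Scoring repeatedly, Team A eventually wins. -/
lemma awins_of_soScoreA_closed {n : ℕ} (hn : 0 < n) {σ : SOSrv} {Q : SOState n → Prop}
    (hQ : ∀ i j, i ≤ n → j ≤ n → Q (SOState.game i j σ) → Q (soScoreA n i j σ))
    {i j : ℕ} (hi : i ≤ n) (hj : j ≤ n) (h : Q (SOState.game i j σ)) : Q SOState.Awins := by
  have at_top : ∀ j, j ≤ n → Q (SOState.game n j σ) → Q SOState.Awins := by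
    intro j hj h
    simpa [soScoreA, show n ≠ n - 1 by omega] using hQ n j le_rfl hj h
  have at_deuce : Q (SOState.game (n - 1) (n - 1) σ) → Q SOState.Awins := by
    intro h
    refine at_top (n - 1) (by omega) ?_
    simpa [soScoreA] using hQ (n - 1) (n - 1) (by omega) (by omega) h
  have at_pred : ∀ j, j ≤ n → Q (SOState.game (n - 1) j σ) → Q SOState.Awins := by
    intro j hj h
    have h' := hQ (n - 1) j (by omega) hj h
    rw [soScoreA, if_pos rfl] at h'
    split_ifs at h'
    · exact at_top _ (by omega) h'
    · exact at_deuce h'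
    · exact h'
  rcases hi.eq_or_lt with rfl | hlt
  · exact at_top j hj h
  have hle : i ≤ n - 1 := by omega
  clear hi hlt
  induction hle using Nat.decreasingInduction with
  | self => exact at_pred j hj h
  | of_succ i hi ih =>
    refine ih ?_
    simpa [soScoreA, show i ≠ n - 1 by omega, show i ≠ n by omega] using
      hQ i j (by omega) hj h

/-- Scoring repeatedly, Team B eventually wins. -/
lemma bwins_of_soScoreB_closed {n : ℕ} (hn : 0 < n) {σ : SOSrv} {Q : SOState n → Prop}
    (hQ : ∀ i j, i ≤ n → j ≤ n → Q (SOState.game i j σ) → Q (soScoreB n i j σ))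
    {i j : ℕ} (hi : i ≤ n) (hj : j ≤ n) (h : Q (SOState.game i j σ)) : Q SOState.Bwins := by
  have hσ : σ.swap_s10.swap_s10 = σ := by cases σ <;> rfl
  refine awins_of_soScoreA_closed (σ := σ.swap_s10) (Q := fun s => Q s.swap_s10) hn
    (fun a b ha hb hab => ?_) hj hi (by simpa [SOState.swap_s10, hσ] using h)
  rw [swap_soScoreA, hσ]
  exact hQ b a hb ha (by simpa [SOState.swap_s10, hσ] using hab)

/-- Winning every rally on serve, the serving team eventually wins the game. -/
lemma SOSrv.wins_of_winState_closed {n : ℕ} (hn : 0 < n) {σ : SOSrv} {Q : SOState n → Prop}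
    (hQ : ∀ i j, i ≤ n → j ≤ n → Q (SOState.game i j σ) → Q (σ.winState n i j))
    {i j : ℕ} (hi : i ≤ n) (hj : j ≤ n) (h : Q (SOState.game i j σ)) :
    Q SOState.Awins ∨ Q SOState.Bwins := by
  cases σ
  exacts [Or.inl (awins_of_soScoreA_closed hn hQ hi hj h),
    Or.inl (awins_of_soScoreA_closed hn hQ hi hj h),
    Or.inr (bwins_of_soScoreB_closed hn hQ hi hj h),
    Or.inr (bwins_of_soScoreB_closed hn hQ hi hj h)]

/-- A function on states is harmonic if it is invariant under averaging over one rally. -/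
def HyHarmonic (n : ℕ) (pA pB : ℝ) (h : SOState n → ℝ) : Prop :=
  ∀ i j (σ : SOSrv), h (SOState.game i j σ) =
    σ.winProb pA pB * h (σ.winState n i j) + (1 - σ.winProb pA pB) * h (σ.loseState n i j)

/-- Maximum principle: a harmonic function vanishing at the absorbing states is nonpositive
at every bounded score. -/
lemma HyHarmonic.nonpos {n : ℕ} (hn : 0 < n) {pA pB : ℝ}
    (hA : pA ∈ Set.Icc (0 : ℝ) 1) (hB : pB ∈ Set.Icc (0 : ℝ) 1) (hpos : 0 < pA + pB)
    {h : SOState n → ℝ} (hh : HyHarmonic n pA pB h)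
    (hAw : h SOState.Awins = 0) (hBw : h SOState.Bwins = 0)
    {s : SOState n} (hs : s.Bounded) : h s ≤ 0 := by
  classical
  let F : Finset (ℕ × ℕ × SOSrv) := Finset.range (n + 1) ×ˢ Finset.range (n + 1) ×ˢ
    {SOSrv.A1, SOSrv.A2, SOSrv.B1, SOSrv.B2}
  have hF : ∀ i j σ, i ≤ n → j ≤ n → (i, j, σ) ∈ F := by
    intro i j σ hi hj
    cases σ <;> simp [F] <;> omega
  obtain ⟨⟨i, j, σ⟩, hmem, hmax⟩ := F.exists_max_image
    (fun x => h (SOState.game x.1 x.2.1 x.2.2)) ⟨_, hF 0 0 SOSrv.A1 (by omega) (by omega)⟩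
  have hi : i ≤ n := by simp [F] at hmem; omega
  have hj : j ≤ n := by simp [F] at hmem; omega
  dsimp only at hmax
  obtain ⟨M, hM⟩ : ∃ M, h (SOState.game i j σ) = M := ⟨_, rfl⟩
  rw [hM] at hmax
  by_contra! hspos
  have hMpos : 0 < M := by
    rcases s with ⟨a, b, τ⟩ | _ | _
    · exact hspos.trans_le (hmax _ (hF a b τ hs.1 hs.2))
    · exact absurd hAw hspos.ne'
    · exact absurd hBw hspos.ne'
  have hle : ∀ t : SOState n, t.Bounded → h t ≤ M := by
    rintro (⟨a, b, τ⟩ | _ | _) ht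
    · exact hmax _ (hF a b τ ht.1 ht.2)
    · exact hAw.trans_le hMpos.le
    · exact hBw.trans_le hMpos.le
  have key : ∀ (τ : SOSrv) a b, a ≤ n → b ≤ n → h (SOState.game a b τ) = M →
      τ.winProb pA pB = 0 ∧ ∃ a' b', a' ≤ n ∧ b' ≤ n ∧ h (SOState.game a' b' τ.next_s10) = M := by
    intro τ a b ha hb hab
    obtain ⟨h0, h1⟩ := τ.winProb_mem_Icc hA hB
    have hzero : τ.winProb pA pB = 0 := by
      by_contra hne
      have hp : 0 < τ.winProb pA pB := lt_of_le_of_ne h0 (Ne.symm hne)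
      have := τ.wins_of_winState_closed hn (Q := fun t => h t = M) (fun a b ha hb hab => by
        have e := hh a b τ
        have h2 := hle _ (τ.bounded_winState ha hb)
        have h3 := hle _ (τ.bounded_loseState ha hb)
        nlinarith [mul_le_mul_of_nonneg_left h3 (sub_nonneg.2 h1)]) ha hb hab
      rcases this with h2 | h2
      · exact hMpos.ne (hAw.symm.trans h2)
      · exact hMpos.ne (hBw.symm.trans h2)
    refine ⟨hzero, ?_⟩
    have e := hh a b τ
    rw [hzero, hab, zero_mul, zero_add, sub_zero, one_mul] at e
    rcases τ.loseState_cases ha hb with h2 | h2 | ⟨a', b', ha', hb', h2⟩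
    · rw [h2, hAw] at e; exact absurd e hMpos.ne'
    · rw [h2, hBw] at e; exact absurd e hMpos.ne'
    · exact ⟨a', b', ha', hb', by rw [← h2, ← e]⟩
  obtain ⟨z₁, a₁, b₁, ha₁, hb₁, e₁⟩ := key σ i j hi hj hM
  obtain ⟨z₂, a₂, b₂, ha₂, hb₂, e₂⟩ := key _ _ _ ha₁ hb₁ e₁
  obtain ⟨z₃, -⟩ := key _ _ _ ha₂ hb₂ e₂
  cases σ <;> simp only [SOSrv.next_s10, SOSrv.winProb] at z₁ z₂ z₃ <;> linarith

lemma hyDist_game_succ (n : ℕ) (pA pB : ℝ) (k i j : ℕ) (σ : SOSrv) (t : SOState n) :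
    hyDist n pA pB (k + 1) (SOState.game i j σ) t =
      σ.winProb pA pB * hyDist n pA pB k (σ.winState n i j) t +
        (1 - σ.winProb pA pB) * hyDist n pA pB k (σ.loseState n i j) t := by
  cases σ <;> rfl

lemma hyDist_awins (n : ℕ) (pA pB : ℝ) (k : ℕ) (t : SOState n) :
    hyDist n pA pB k SOState.Awins t = if t = SOState.Awins then 1 else 0 := by
  induction k with
  | zero => rfl
  | succ k ih => exact ih

lemma hyDist_bwins (n : ℕ) (pA pB : ℝ) (k : ℕ) (t : SOState n) :
    hyDist n pA pB k SOState.Bwins t = if t = SOState.Bwins then 1 else 0 := by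
  induction k with
  | zero => rfl
  | succ k ih => exact ih

lemma hyDist_swap (n : ℕ) (pA pB : ℝ) (k : ℕ) (s t : SOState n) :
    hyDist n pA pB k s.swap_s10 t.swap_s10 = hyDist n pB pA k s t := by
  induction k generalizing s with
  | zero => simp only [hyDist, SOState.swap_inj]
  | succ k ih =>
    rcases s with ⟨i, j, σ⟩ | _ | _
    · rw [SOState.swap_s10, hyDist_game_succ, hyDist_game_succ, σ.winState_swap, σ.loseState_swap,
        ih, ih, σ.winProb_swap]
    · exact ih SOState.Awins
    · exact ih SOState.Bwins

lemma hyWinA_swap (n : ℕ) (pA pB : ℝ) (s : SOState n) :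
    hyWinA n pA pB s.swap_s10 = hyWinB n pB pA s :=
  iSup_congr fun k => hyDist_swap n pA pB k s SOState.Bwins

lemma hyDist_mem_Icc (n : ℕ) {pA pB : ℝ} (hA : pA ∈ Set.Icc (0 : ℝ) 1)
    (hB : pB ∈ Set.Icc (0 : ℝ) 1) (k : ℕ) (s t : SOState n) :
    hyDist n pA pB k s t ∈ Set.Icc (0 : ℝ) 1 := by
  induction k generalizing s with
  | zero => simp only [hyDist]; split_ifs <;> simp
  | succ k ih =>
    rcases s with ⟨i, j, σ⟩ | _ | _
    · obtain ⟨h0, h1⟩ := σ.winProb_mem_Icc hA hB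
      rw [hyDist_game_succ]
      exact convex_Icc (0 : ℝ) 1 (ih _) (ih _) h0 (sub_nonneg.2 h1) (by ring)
    · exact ih SOState.Awins
    · exact ih SOState.Bwins

lemma hyDist_le_succ_awins (n : ℕ) {pA pB : ℝ} (hA : pA ∈ Set.Icc (0 : ℝ) 1)
    (hB : pB ∈ Set.Icc (0 : ℝ) 1) (k : ℕ) (s : SOState n) :
    hyDist n pA pB k s SOState.Awins ≤ hyDist n pA pB (k + 1) s SOState.Awins := by
  induction k generalizing s with
  | zero =>
    rcases s with ⟨i, j, σ⟩ | _ | _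
    · exact (hyDist_mem_Icc n hA hB 1 _ _).1
    · exact le_rfl
    · exact le_rfl
  | succ k ih =>
    rcases s with ⟨i, j, σ⟩ | _ | _
    · obtain ⟨h0, h1⟩ := σ.winProb_mem_Icc hA hB
      rw [hyDist_game_succ, hyDist_game_succ]
      exact add_le_add (mul_le_mul_of_nonneg_left (ih _) h0)
        (mul_le_mul_of_nonneg_left (ih _) (sub_nonneg.2 h1))
    · exact ih SOState.Awins
    · exact ih SOState.Bwins

lemma tendsto_hyDist_awins (n : ℕ) {pA pB : ℝ} (hA : pA ∈ Set.Icc (0 : ℝ) 1)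
    (hB : pB ∈ Set.Icc (0 : ℝ) 1) (s : SOState n) :
    Filter.Tendsto (fun k => hyDist n pA pB k s SOState.Awins) Filter.atTop
      (nhds (hyWinA n pA pB s)) :=
  tendsto_atTop_ciSup (monotone_nat_of_le_succ fun k => hyDist_le_succ_awins n hA hB k s)
    ⟨1, by rintro _ ⟨k, rfl⟩; exact (hyDist_mem_Icc n hA hB k s _).2⟩

lemma hyHarmonic_hyWinA (n : ℕ) {pA pB : ℝ} (hA : pA ∈ Set.Icc (0 : ℝ) 1)
    (hB : pB ∈ Set.Icc (0 : ℝ) 1) : HyHarmonic n pA pB (hyWinA n pA pB) := by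
  intro i j σ
  refine tendsto_nhds_unique ((Filter.tendsto_add_atTop_iff_nat 1).2
    (tendsto_hyDist_awins n hA hB (SOState.game i j σ))) ?_
  simp only [hyDist_game_succ]
  exact ((tendsto_hyDist_awins n hA hB _).const_mul _).add
    ((tendsto_hyDist_awins n hA hB _).const_mul _)

lemma hyHarmonic_hyWinB (n : ℕ) {pA pB : ℝ} (hA : pA ∈ Set.Icc (0 : ℝ) 1)
    (hB : pB ∈ Set.Icc (0 : ℝ) 1) : HyHarmonic n pA pB (hyWinB n pA pB) := by
  intro i j σ
  rw [← hyWinA_swap, ← hyWinA_swap, ← hyWinA_swap, ← σ.winState_swap, ← σ.loseState_swap,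
    ← σ.winProb_swap]
  exact hyHarmonic_hyWinA n hB hA j i σ.swap_s10

/-- The game ends almost surely. -/
lemma hyWinA_add_hyWinB {n : ℕ} (hn : 0 < n) {pA pB : ℝ} (hA : pA ∈ Set.Icc (0 : ℝ) 1)
    (hB : pB ∈ Set.Icc (0 : ℝ) 1) (hpos : 0 < pA + pB) {s : SOState n} (hs : s.Bounded) :
    hyWinA n pA pB s + hyWinB n pA pB s = 1 := by
  have harm_A := hyHarmonic_hyWinA n hA hB
  have harm_B := hyHarmonic_hyWinB n hA hB
  have upper : hyWinA n pA pB s + hyWinB n pA pB s - 1 ≤ 0 :=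
    HyHarmonic.nonpos (h := fun t => hyWinA n pA pB t + hyWinB n pA pB t - 1) hn hA hB hpos
      (fun i j σ => by
        simp only [harm_A i j σ, harm_B i j σ]
        ring)
      (by simp [hyWinA, hyWinB, hyDist_awins]) (by simp [hyWinA, hyWinB, hyDist_bwins]) hs
  have lower : 1 - (hyWinA n pA pB s + hyWinB n pA pB s) ≤ 0 :=
    HyHarmonic.nonpos (h := fun t => 1 - (hyWinA n pA pB t + hyWinB n pA pB t)) hn hA hB hpos
      (fun i j σ => by
        simp only [harm_A i j σ, harm_B i j σ]
        ring)
      (by simp [hyWinA, hyWinB, hyDist_awins]) (by simp [hyWinA, hyWinB, hyDist_bwins]) hs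
  linarith

/-- For every integer `n ≥ 4` and all `p_A, p_B ∈ [0,1]` with
`p_A + p_B > 0`, the first-serving team's advantage under hybrid rally scoring is a
symmetric function of the two rally-win probabilities. -/
theorem hyAdv_symm (n : ℕ) (hn : 4 ≤ n) (pA pB : ℝ)
    (hA : pA ∈ Set.Icc (0 : ℝ) 1) (hB : pB ∈ Set.Icc (0 : ℝ) 1)
    (hpos : 0 < pA + pB) :
    hyAdv n pA pB = hyAdv n pB pA := by
  have hn' : 0 < n := by omega
  have endA := hyWinA_add_hyWinB hn' hA hB hpos
    (s := SOState.game 0 0 SOSrv.A2) ⟨n.zero_le, n.zero_le⟩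
  have endB := hyWinA_add_hyWinB hn' hA hB hpos
    (s := SOState.game 0 0 SOSrv.B2) ⟨n.zero_le, n.zero_le⟩
  have swapA : hyWinA n pB pA (SOState.game 0 0 SOSrv.B2) =
      hyWinB n pA pB (SOState.game 0 0 SOSrv.A2) :=
    hyWinA_swap n pB pA (SOState.game 0 0 SOSrv.A2)
  have swapB : hyWinA n pB pA (SOState.game 0 0 SOSrv.A2) =
      hyWinB n pA pB (SOState.game 0 0 SOSrv.B2) :=
    hyWinA_swap n pB pA (SOState.game 0 0 SOSrv.B2)
  unfold hyAdv
  linarith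
end
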